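/- arXiv:2310.02336 — 6 statements merged into one kernel-verified Lean document; each statement's English description precedes it below -/
import Mathlib

section
/- For every integer a ≥ 0, if a finite simple graph G satisfies χ(G) + θ(G) ≥ |G| + 1 − a, then G is (a+1)-HNG; that is, every induced subgraph H of G satisfies χ(H) + θ(H) ≥ |H| − a. -/
open SimpleGraph

/-- The chromatic number of `G` as a natural number. -/
noncomputable def chi {V : Type*} (G : SimpleGraph V) : ℕ := G.chromaticNumber.toNat

/-- The clique cover number of `G`: the chromatic number of the complement. -/
noncomputable def theta {V : Type*} (G : SimpleGraph V) : ℕ := chi Gᶜ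

/-- `G` is `a`-hereditary-Nordhaus-Gaddum: every induced subgraph `H`
satisfies `χ(H) + θ(H) ≥ |H| + 1 - a`. -/
def IsHNG {V : Type*} [Fintype V] (G : SimpleGraph V) (a : ℕ) : Prop :=
  ∀ s : Finset V, s.card + 1 - a ≤ chi (G.induce (s : Set V)) + theta (G.induce (s : Set V))

/-- `G` restricted to `s` can be properly coloured with the colours `0, …, k - 1`. -/
def ColorableOn {V : Type*} (G : SimpleGraph V) (s : Finset V) (k : ℕ) : Prop :=
  ∃ f : V → ℕ, (∀ x ∈ s, f x < k) ∧ ∀ x ∈ s, ∀ y ∈ s, G.Adj x y → f x ≠ f y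

theorem ColorableOn.chi_le {V : Type*} [Fintype V] {G : SimpleGraph V} {k : ℕ}
    (h : ColorableOn G Finset.univ k) : chi G ≤ k := by
  obtain ⟨f, hk, hf⟩ := h
  have hc : G.Colorable k :=
    ⟨Coloring.mk (fun x => ⟨f x, hk x (Finset.mem_univ x)⟩) fun {x y} hxy he =>
      hf x (Finset.mem_univ x) y (Finset.mem_univ y) hxy (congrArg Fin.val he)⟩
  exact ENat.toNat_le_of_le_natCast hc.chromaticNumber_le

theorem colorableOn_chi_induce {V : Type*} (G : SimpleGraph V) (s : Finset V) :
    ColorableOn G s (chi (G.induce (s : Set V))) := by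
  classical
  obtain ⟨c⟩ : (G.induce (s : Set V)).Colorable (chi (G.induce (s : Set V))) :=
    colorable_chromaticNumber (G.induce (s : Set V)).colorable_of_fintype
  refine ⟨fun x => if hx : x ∈ s then c ⟨x, hx⟩ else 0, fun x hx => ?_, fun x hx y hy hxy => ?_⟩
  · simp [hx]
  · have hne : c ⟨x, hx⟩ ≠ c ⟨y, hy⟩ := c.valid hxy
    simpa [hx, hy, Fin.val_inj] using hne

theorem theta_induce {V : Type*} (G : SimpleGraph V) (s : Set V) :
    theta (G.induce s) = chi (Gᶜ.induce s) := by
  have h : (G.induce s)ᶜ = Gᶜ.induce s := by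
    ext x y
    simp [Subtype.ext_iff]
  rw [theta, h]

theorem ColorableOn.union {V : Type*} [DecidableEq V] {G : SimpleGraph V} {s t : Finset V}
    {k l : ℕ} (hs : ColorableOn G s k) (ht : ColorableOn G t l) :
    ColorableOn G (s ∪ t) (k + l) := by
  obtain ⟨f, hfk, hf⟩ := hs
  obtain ⟨g, hgl, hg⟩ := ht
  refine ⟨fun x => if x ∈ s then f x else k + g x, fun x hx => ?_, fun x hx y hy hxy => ?_⟩
  · grind
  · grind

theorem colorableOn_singleton {V : Type*} (G : SimpleGraph V) (v : V) :
    ColorableOn G {v} 1 :=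
  ⟨fun _ => 0, by simp, by simp⟩

theorem ColorableOn.insert_succ {V : Type*} [DecidableEq V] {G : SimpleGraph V} {s : Finset V}
    {k : ℕ} (h : ColorableOn G s k) (v : V) : ColorableOn G (insert v s) (k + 1) := by
  simpa [Finset.union_comm s] using h.union (colorableOn_singleton G v)

/-- Greedy extension of a colouring to a vertex with fewer neighbours than colours. -/
theorem ColorableOn.insert_of_card_lt {V : Type*} [DecidableEq V] {G : SimpleGraph V}
    [DecidableRel G.Adj] {s : Finset V} {k : ℕ} (h : ColorableOn G s k) {v : V} (hv : v ∉ s)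
    (hcard : (s.filter (G.Adj v)).card < k) : ColorableOn G (insert v s) k := by
  obtain ⟨f, hk, hf⟩ := h
  obtain ⟨c, hck, hc⟩ : ∃ c ∈ Finset.range k, c ∉ (s.filter (G.Adj v)).image f :=
    Finset.exists_mem_notMem_of_card_lt_card
      (by simpa using Finset.card_image_le.trans_lt hcard)
  have hc' : ∀ x ∈ s, G.Adj v x → f x ≠ c := fun x hx hvx he =>
    hc (Finset.mem_image.2 ⟨x, Finset.mem_filter.2 ⟨hx, hvx⟩, he⟩)
  refine ⟨Function.update f v c, fun x hx => ?_, fun x hx y hy hxy => ?_⟩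
  · rcases Finset.mem_insert.1 hx with rfl | hx
    · simpa using hck
    · rw [Function.update_of_ne (ne_of_mem_of_not_mem hx hv)]
      exact hk x hx
  · rcases Finset.mem_insert.1 hx with rfl | hxs <;>
      rcases Finset.mem_insert.1 hy with rfl | hys
    · exact (hxy.ne rfl).elim
    · rw [Function.update_self, Function.update_of_ne (ne_of_mem_of_not_mem hys hv)]
      exact (hc' y hys hxy).symm
    · rw [Function.update_self, Function.update_of_ne (ne_of_mem_of_not_mem hxs hv)]
      exact hc' x hxs hxy.symm
    · rw [Function.update_of_ne (ne_of_mem_of_not_mem hxs hv),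
        Function.update_of_ne (ne_of_mem_of_not_mem hys hv)]
      exact hf x hxs y hys hxy

/-- The Nordhaus–Gaddum inequality for the subgraph induced on `s`. -/
theorem exists_colorableOn_add_le {V : Type*} (G : SimpleGraph V) (s : Finset V) :
    ∃ k l : ℕ, ColorableOn G s k ∧ ColorableOn Gᶜ s l ∧ k + l ≤ s.card + 1 := by
  classical
  induction s using Finset.induction_on with
  | empty => exact ⟨0, 0, ⟨fun _ => 0, by simp, by simp⟩, ⟨fun _ => 0, by simp, by simp⟩, by simp⟩
  | insert v s hv ih =>
    obtain ⟨k, l, hk, hl, hkl⟩ := ih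
    rw [Finset.card_insert_of_notMem hv]
    by_cases h₁ : (s.filter (G.Adj v)).card < k
    · exact ⟨k, l + 1, hk.insert_of_card_lt hv h₁, hl.insert_succ v, by omega⟩
    by_cases h₂ : (s.filter (Gᶜ.Adj v)).card < l
    · exact ⟨k + 1, l, hk.insert_succ v, hl.insert_of_card_lt hv h₂, by omega⟩
    have hdisj : Disjoint (s.filter (G.Adj v)) (s.filter (Gᶜ.Adj v)) :=
      Finset.disjoint_filter.2 fun x _ hx hx' => ((compl_adj G v x).1 hx').2 hx
    have hle : (s.filter (G.Adj v)).card + (s.filter (Gᶜ.Adj v)).card ≤ s.card := by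
      rw [← Finset.card_union_of_disjoint hdisj]
      exact Finset.card_le_card
        (Finset.union_subset (Finset.filter_subset _ _) (Finset.filter_subset _ _))
    exact ⟨k + 1, l + 1, hk.insert_succ v, hl.insert_succ v, by omega⟩

/-- If `χ(G) + θ(G) ≥ |G| + 1 - a`, then `G` is `(a+1)`-HNG: every induced
subgraph `H` satisfies `χ(H) + θ(H) ≥ |H| - a`. -/
theorem stmt_0 {V : Type*} [Fintype V] (G : SimpleGraph V) (a : ℕ)
    (h : Fintype.card V + 1 - a ≤ chi G + theta G) :
    IsHNG G (a + 1) := by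
  classical
  intro s
  rw [theta_induce]
  obtain ⟨k, l, hk, hl, hkl⟩ := exists_colorableOn_add_le G sᶜ
  have hchi : chi G ≤ chi (G.induce (s : Set V)) + k :=
    ColorableOn.chi_le (by simpa using (colorableOn_chi_induce G s).union hk)
  have htheta : theta G ≤ chi (Gᶜ.induce (s : Set V)) + l :=
    ColorableOn.chi_le (by simpa using (colorableOn_chi_induce Gᶜ s).union hl)
  have hcard := Finset.card_add_card_compl s
  omega
end

section
/- For every integer a ≥ 0, the path P_{2a+4} on 2a+4 vertices is (a+1)-HNG, i.e., every induced subgraph H of P_{2a+4} satisfies χ(H) + θ(H) ≥ |H| − a; moreover χ(P_{2a+4}) + θ(P_{2a+4}) = (2a+4) − a, so P_{2a+4} fails the inequality χ + θ ≥ n + 1 − a. -/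
open SimpleGraph

lemma chi_le_of_colorable {V : Type*} {G : SimpleGraph V} {k : ℕ} (h : G.Colorable k) :
    chi G ≤ k :=
  ENat.toNat_le_of_le_natCast h.chromaticNumber_le

lemma colorable_chi {V : Type*} [Finite V] (G : SimpleGraph V) : G.Colorable (chi G) := by
  have := Fintype.ofFinite V
  exact colorable_chromaticNumber G.colorable_of_fintype

lemma two_le_chi_of_adj {V : Type*} [Finite V] {G : SimpleGraph V} {u v : V} (h : G.Adj u v) :
    2 ≤ chi G := by
  obtain ⟨C⟩ := colorable_chi G
  have hne := C.valid h
  by_contra! hlt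
  exact hne (Fin.ext (by have := (C u).isLt; have := (C v).isLt; omega))

/-- In a triangle-free graph every clique of a clique cover has at most two vertices. -/
lemma card_le_two_mul_theta {V : Type*} [Fintype V] {G : SimpleGraph V} (hG : G.CliqueFree 3) :
    Fintype.card V ≤ 2 * theta G := by
  classical
  obtain ⟨C⟩ := colorable_chi Gᶜ
  have key := Finset.card_le_mul_card_image_of_maps_to (s := (Finset.univ : Finset V))
    (t := Finset.univ) (f := C) (fun _ _ => Finset.mem_univ _) 2 (fun c _ => by
      by_contra! hlt
      obtain ⟨x, y, z, hx, hy, hz, hxy, hxz, hyz⟩ := Finset.two_lt_card_iff.mp hlt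
      simp only [Finset.mem_filter, Finset.mem_univ, true_and] at hx hy hz
      have adj : ∀ {p q : V}, p ≠ q → C p = C q → G.Adj p q := fun hpq hC => by
        by_contra hn
        exact C.valid ((compl_adj G _ _).mpr ⟨hpq, hn⟩) hC
      exact hG {x, y, z} (is3Clique_triple_iff.mpr
        ⟨adj hxy (hx.trans hy.symm), adj hxz (hx.trans hz.symm), adj hyz (hy.trans hz.symm)⟩))
  simpa [theta] using key

lemma card_le_theta_of_edgeless {V : Type*} [Fintype V] {G : SimpleGraph V}
    (hG : ∀ u v, ¬ G.Adj u v) : Fintype.card V ≤ theta G := by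
  obtain ⟨C⟩ := colorable_chi Gᶜ
  have hinj : Function.Injective C := fun u v huv => by
    by_contra hne
    exact C.valid ((compl_adj G _ _).mpr ⟨hne, hG u v⟩) huv
  simpa [theta] using Fintype.card_le_of_injective C hinj

lemma pathGraph_cliqueFree_three (n : ℕ) : (pathGraph n).CliqueFree 3 := by
  intro s hs
  obtain ⟨x, y, z, hxy, hxz, hyz, -⟩ := is3Clique_iff.mp hs
  rw [pathGraph_adj] at hxy hxz hyz
  omega

lemma theta_pathGraph_two_mul (k : ℕ) : theta (pathGraph (2 * k)) = k := by
  apply le_antisymm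
  · refine chi_le_of_colorable ⟨Coloring.mk (fun v => ⟨v.val / 2, by omega⟩) ?_⟩
    intro u v huv heq
    rw [compl_adj, pathGraph_adj] at huv
    have hne : u.val ≠ v.val := fun h => huv.1 (Fin.ext h)
    have hdiv : u.val / 2 = v.val / 2 := congrArg Fin.val heq
    omega
  · have := card_le_two_mul_theta (pathGraph_cliqueFree_three (2 * k))
    rw [Fintype.card_fin] at this
    omega

/-- The path `P_{2a+4}` is `(a+1)`-HNG, and moreover
`χ(P_{2a+4}) + θ(P_{2a+4}) = (2a+4) - a`, so it fails `χ + θ ≥ n + 1 - a`. -/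
theorem stmt_1 (a : ℕ) :
    IsHNG (pathGraph (2 * a + 4)) (a + 1) ∧
    chi (pathGraph (2 * a + 4)) + theta (pathGraph (2 * a + 4)) = (2 * a + 4) - a ∧
    ¬ ((2 * a + 4) + 1 - a ≤ chi (pathGraph (2 * a + 4)) + theta (pathGraph (2 * a + 4))) := by
  have hchi : chi (pathGraph (2 * a + 4)) = 2 := by
    rw [chi, chromaticNumber_pathGraph _ (by omega)]
    rfl
  have htheta : theta (pathGraph (2 * a + 4)) = a + 2 := theta_pathGraph_two_mul (a + 2)
  refine ⟨fun s => ?_, by omega, by omega⟩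
  have hcard : Fintype.card (s : Set (Fin (2 * a + 4))) = s.card := by simp
  have hs : s.card ≤ 2 * a + 4 := by simpa using s.card_le_univ
  by_cases hE : ∃ u v, ((pathGraph (2 * a + 4)).induce (s : Set (Fin (2 * a + 4)))).Adj u v
  · obtain ⟨u, v, huv⟩ := hE
    have h2 := two_le_chi_of_adj huv
    have h3 := card_le_two_mul_theta ((pathGraph_cliqueFree_three (2 * a + 4)).comap
      (Embedding.induce (s : Set (Fin (2 * a + 4)))).isContained)
    omega
  · push Not at hE
    have := card_le_theta_of_edgeless hE
    omega
end

section
/- Fix an integer a ≥ 0 and let G be a finite simple graph that is a minimal forbidden induced subgraph for a-HNG, i.e., χ(G) + θ(G) < |G| + 1 − a but every proper induced subgraph H of G satisfies χ(H) + θ(H) ≥ |H| + 1 − a. Then χ(G) + θ(G) = |G| − a (so G is (a+1)-HNG), and for every vertex v of G, χ(G − v) = χ(G) and θ(G − v) = θ(G) (no vertex of G is χ-distinct or θ-distinct). -/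
open SimpleGraph

/-- A homomorphism into a graph on finitely many vertices bounds the chromatic number. -/
lemma chi_le_of_hom {V W : Type*} [Finite W] {G : SimpleGraph V} {H : SimpleGraph W}
    (f : G →g H) : chi G ≤ chi H :=
  ENat.toNat_le_toNat (chromaticNumber_mono_of_hom f)
    (chromaticNumber_ne_top_iff_exists.2 ⟨_, colorable_chromaticNumber_of_fintype H⟩)

/-- An embedding into a graph on finitely many vertices bounds the clique cover number. -/
lemma theta_le_of_embedding {V W : Type*} [Finite W] {G : SimpleGraph V} {H : SimpleGraph W}
    (f : G ↪g H) : theta G ≤ theta H :=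
  chi_le_of_hom (Embedding.complEquiv f).toHom

/-- If `G` is a minimal forbidden induced subgraph for `a`-HNG
(`χ(G) + θ(G) < |G| + 1 - a` but every proper induced subgraph satisfies the
bound), then `χ(G) + θ(G) = |G| - a` (so `G` is `(a+1)`-HNG) and deleting any
vertex changes neither `χ` nor `θ`. -/
theorem stmt_8 {V : Type*} [Fintype V] (G : SimpleGraph V) (a : ℕ)
    (hbad : chi G + theta G < Fintype.card V + 1 - a)
    (hmin : ∀ s : Finset V, s ≠ Finset.univ →
      s.card + 1 - a ≤ chi (G.induce (s : Set V)) + theta (G.induce (s : Set V))) :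
    chi G + theta G = Fintype.card V - a ∧ IsHNG G (a + 1) ∧
    ∀ v : V, chi (G.induce ({v}ᶜ : Set V)) = chi G ∧
      theta (G.induce ({v}ᶜ : Set V)) = theta G := by
  classical
  have hchi (s : Set V) : chi (G.induce s) ≤ chi G := chi_le_of_hom (Embedding.induce s).toHom
  have htheta (s : Set V) : theta (G.induce s) ≤ theta G :=
    theta_le_of_embedding (Embedding.induce s)
  have hdel (v : V) : Fintype.card V - a ≤
      chi (G.induce ({v}ᶜ : Set V)) + theta (G.induce ({v}ᶜ : Set V)) := by
    have h := hmin {v}ᶜ (by simp)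
    have hpos : 0 < Fintype.card V := Fintype.card_pos_iff.2 ⟨v⟩
    rw [Finset.card_compl, Finset.card_singleton, Finset.coe_compl, Finset.coe_singleton] at h
    omega
  have hsum : chi G + theta G = Fintype.card V - a := by
    rcases isEmpty_or_nonempty V with hV | ⟨⟨v⟩⟩
    · have := Fintype.card_eq_zero (α := V)
      omega
    · have := hdel v
      have := hchi {v}ᶜ
      have := htheta {v}ᶜ
      omega
  refine ⟨hsum, fun s => ?_, fun v => ?_⟩
  · by_cases hs : s = Finset.univ
    · subst hs
      have e : G ↪g G.induce ((Finset.univ : Finset V) : Set V) :=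
        ⟨⟨fun v => ⟨v, by simp⟩, fun v w h => congrArg Subtype.val h⟩, Iff.rfl⟩
      have := chi_le_of_hom e.toHom
      have := theta_le_of_embedding e
      rw [Finset.card_univ]
      omega
    · have := hmin s hs
      omega
  · have := hdel v
    have := hchi {v}ᶜ
    have := htheta {v}ᶜ
    omega
end

section
/- If a finite simple graph G is 1-HNG, then χ(G) ≤ ω(G) + 1. In particular, the class of 1-HNG graphs is χ-bounded by the function f(x) = x + 1. -/
open SimpleGraph

lemma chi_le_card {W α : Type*} (H : SimpleGraph W) (f : W → α) (C : Finset α)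
    (hf : ∀ w, f w ∈ C) (hadj : ∀ u v, H.Adj u v → f u ≠ f v) : chi H ≤ C.card := by
  have hcol : H.Colorable C.card := by
    have c : H.Coloring C := Coloring.mk (fun w => ⟨f w, hf w⟩) (by
      intro u v h e
      exact hadj u v h (congrArg Subtype.val e))
    simpa using c.colorable
  exact ENat.toNat_le_of_le_natCast hcol.chromaticNumber_le

/-- In a `1`-HNG graph, a set cannot be partitioned both into few stable sets and into
few cliques. -/
lemma IsHNG.card_le {V α β : Type*} [Fintype V] {G : SimpleGraph V} (hG : IsHNG G 1)
    (s : Finset V) (f : V → α) (C : Finset α) (hf : ∀ v ∈ s, f v ∈ C)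
    (hadj : ∀ u ∈ s, ∀ v ∈ s, G.Adj u v → f u ≠ f v)
    (g : V → β) (D : Finset β) (hg : ∀ v ∈ s, g v ∈ D)
    (hnadj : ∀ u ∈ s, ∀ v ∈ s, u ≠ v → g u = g v → G.Adj u v) :
    s.card ≤ C.card + D.card := by
  have h := hG s
  have h1 : chi (G.induce (s : Set V)) ≤ C.card := by
    refine chi_le_card _ (fun v => f v.1) C (fun v => hf v.1 (Finset.mem_coe.1 v.2)) ?_
    intro u v huv
    exact hadj u.1 (Finset.mem_coe.1 u.2) v.1 (Finset.mem_coe.1 v.2) (induce_adj.1 huv)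
  have h2 : theta (G.induce (s : Set V)) ≤ D.card := by
    refine chi_le_card _ (fun v => g v.1) D (fun v => hg v.1 (Finset.mem_coe.1 v.2)) ?_
    intro u v huv e
    rw [compl_adj] at huv
    exact huv.2 (induce_adj.2 (hnadj u.1 (Finset.mem_coe.1 u.2) v.1 (Finset.mem_coe.1 v.2)
      (fun e' => huv.1 (Subtype.ext e')) e))
  omega

lemma stable_union_pair {V : Type*} {G : SimpleGraph V} {R : Set V} (hR : ∀ u ∈ R, ∀ v ∈ R, ¬ G.Adj u v) {a b : V}
    (hab : ¬ G.Adj a b) (ha : ∀ u ∈ R, ¬ G.Adj a u) (hb : ∀ u ∈ R, ¬ G.Adj b u) :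
    ∀ u ∈ R ∪ {a, b}, ∀ v ∈ R ∪ {a, b}, ¬ G.Adj u v := by
  rintro u (hu | rfl | rfl) v (hv | rfl | rfl) h
  · exact hR u hu v hv h
  · exact ha u hu h.symm
  · exact hb u hu h.symm
  · exact ha v hv h
  · exact G.irrefl h
  · exact hab h
  · exact hb v hv h
  · exact hab h.symm
  · exact G.irrefl h

section MaximumClique

variable {V : Type*} [Fintype V] {G : SimpleGraph V} {K : Finset V}

/-- A clique disjoint from a maximum clique `K` can be injectively matched to non-neighbours
in `K`. -/
lemma exists_injective_nonadj (hK : G.IsNClique G.cliqueNum K) (Q : Finset V)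
    (hQ : G.IsClique (Q : Set V)) (hd : Disjoint Q K) :
    ∃ f : V → V, Set.InjOn f Q ∧ ∀ q ∈ Q, f q ∈ K ∧ ¬ G.Adj q (f q) := by
  classical
  have hall := (Finset.all_card_le_biUnion_card_iff_exists_injective
    (fun q : Q => K.filter (fun k => ¬ G.Adj q k))).1 (by
      intro A
      set B := A.biUnion (fun q : Q => K.filter (fun k => ¬ G.Adj q k)) with hB
      have hBK : B ⊆ K := by
        intro b hb
        simp only [hB, Finset.mem_biUnion, Finset.mem_filter] at hb
        obtain ⟨_, _, h, _⟩ := hb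
        exact h
      let A' : Finset V := A.map (Function.Embedding.subtype _)
      have hA' : ∀ v ∈ A', v ∈ Q ∧ ∀ k ∈ K, k ∉ B → G.Adj v k := by
        intro v hv
        simp only [A', Finset.mem_map, Function.Embedding.coe_subtype] at hv
        obtain ⟨q, hq, rfl⟩ := hv
        refine ⟨q.2, fun k hk hkB => ?_⟩
        by_contra hn
        exact hkB (Finset.mem_biUnion.2 ⟨q, hq, Finset.mem_filter.2 ⟨hk, hn⟩⟩)
      have hdis : Disjoint (K \ B) A' := by
        rw [Finset.disjoint_left]
        intro v hv hv'
        exact Finset.disjoint_left.1 hd (hA' v hv').1 (Finset.mem_sdiff.1 hv).1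
      have hcl : G.IsClique ((K \ B ∪ A' : Finset V) : Set V) := by
        intro u hu v hv huv
        rw [Finset.mem_coe, Finset.mem_union, Finset.mem_sdiff] at hu hv
        rcases hu with hu | hu <;> rcases hv with hv | hv
        · exact hK.1 hu.1 hv.1 huv
        · exact ((hA' v hv).2 u hu.1 hu.2).symm
        · exact (hA' u hu).2 v hv.1 hv.2
        · exact hQ (hA' u hu).1 (hA' v hv).1 huv
      have h1 := hcl.card_le_cliqueNum
      rw [Finset.card_union_of_disjoint hdis, Finset.card_sdiff_of_subset hBK, hK.2,
        Finset.card_map] at h1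
      have h2 := Finset.card_le_card hBK
      rw [hK.2] at h2
      omega)
  obtain ⟨f, hf, hfm⟩ := hall
  refine ⟨fun v => if h : v ∈ Q then f ⟨v, h⟩ else v, ?_, ?_⟩
  · intro u hu v hv h
    have hu' : u ∈ Q := hu
    have hv' : v ∈ Q := hv
    simp only [hu', hv', dif_pos] at h
    exact congrArg Subtype.val (hf h)
  · intro q hq
    simp only [hq, dif_pos]
    simpa using hfm ⟨q, hq⟩

lemma exists_nonadj (hK : G.IsNClique G.cliqueNum K) {p : V} (hp : p ∉ K) :
    ∃ a ∈ K, ¬ G.Adj p a := by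
  obtain ⟨f, -, hf⟩ := exists_injective_nonadj hK {p} (by simp) (by simpa using hp)
  exact ⟨f p, hf p (by simp)⟩

lemma exists_nonadj_pair (hK : G.IsNClique G.cliqueNum K) {p q : V} (hp : p ∉ K) (hq : q ∉ K) :
    ∃ a ∈ K, ∃ b ∈ K, ¬ G.Adj p a ∧ ¬ G.Adj q b ∧ (G.Adj p q → a ≠ b) := by
  classical
  by_cases h : G.Adj p q
  · obtain ⟨f, hi, hf⟩ := exists_injective_nonadj hK {p, q}
      (by simpa using fun _ => h) (by simp [hp, hq])
    have h1 := hf p (by simp)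
    have h2 := hf q (by simp)
    exact ⟨f p, h1.1, f q, h2.1, h1.2, h2.2,
      fun _ e => h.ne (hi (by simp) (by simp) e)⟩
  · obtain ⟨a, ha, ha'⟩ := exists_nonadj hK hp
    obtain ⟨b, hb, hb'⟩ := exists_nonadj hK hq
    exact ⟨a, ha, b, hb, ha', hb', fun h' => absurd h' h⟩

/-- If the vertices of `s` outside a maximum clique `K` form a stable set `S` together with
two vertices and a stable set `Z` with no neighbour among these two, then `s` has a colouring with
one colour for each vertex of `K` and one more colour. -/
lemma exists_coloring (hK : G.IsNClique G.cliqueNum K) (s S Z : Set V)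
    (hS : ∀ u ∈ S, ∀ v ∈ S, ¬ G.Adj u v) {p q : V} (hp : p ∉ K) (hq : q ∉ K)
    (hZ : ∀ u ∈ Z, ∀ v ∈ Z, ¬ G.Adj u v)
    (hpZ : ∀ v ∈ Z, ¬ G.Adj p v) (hqZ : ∀ v ∈ Z, ¬ G.Adj q v)
    (hs : ∀ v ∈ s, v ∉ K → v ∈ S ∨ v = p ∨ v = q ∨ v ∈ Z) :
    ∃ f : V → Option V, (∀ v, f v ∈ K.insertNone) ∧
      ∀ u ∈ s, ∀ v ∈ s, G.Adj u v → f u ≠ f v := by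
  classical
  obtain ⟨a, ha, b, hb, hpa, hqb, hab⟩ := exists_nonadj_pair hK hp hq
  have hc : ∀ v, ∃ c, v ∉ K → c ∈ K ∧ ¬ G.Adj v c := by
    intro v
    by_cases hv : v ∈ K
    · exact ⟨v, fun h => absurd hv h⟩
    · obtain ⟨c, hc⟩ := exists_nonadj hK hv
      exact ⟨c, fun _ => hc⟩
  choose c hc using hc
  refine ⟨fun v => if v ∈ K then some v else if v ∈ S then none else
    if v = p then some a else if v = q then some b else some (c v), fun v => ?_, ?_⟩
  · simp only
    split_ifs <;> simp_all
  · intro u hu v hv huv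
    have h1 := hs u hu
    have h2 := hs v hv
    have h3 := huv.symm
    have h4 := huv.ne
    have h5 := hS u
    have h6 := G.adj_comm p q
    have h7 := hc u
    have h8 := hc v
    have h9 := hZ u
    clear hS hZ hs hc
    simp only
    split_ifs <;> grind

/-- The complement of a maximum clique in a `1`-HNG graph is triangle-free. -/
lemma IsHNG.not_triangle (hG : IsHNG G 1) (hK : G.IsNClique G.cliqueNum K) {x y z : V}
    (hx : x ∉ K) (hy : y ∉ K) (hz : z ∉ K) (hxy : G.Adj x y) (hxz : G.Adj x z)
    (hyz : G.Adj y z) : False := by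
  classical
  have hQ : G.IsClique (({x, y, z} : Finset V) : Set V) := by
    simp [isClique_insert, hxy, hxz, hyz]
  have hd : Disjoint ({x, y, z} : Finset V) K := by simp [hx, hy, hz]
  obtain ⟨f, hi, hf⟩ := exists_injective_nonadj hK _ hQ hd
  have h := hG.card_le (K ∪ {x, y, z}) (fun v => if v ∈ K then v else f v) K
    (by
      intro v hv
      rw [Finset.mem_union] at hv
      by_cases h : v ∈ K
      · simp [h]
      · simpa [h] using (hf v (hv.resolve_left h)).1)
    (by
      intro u hu v hv huv
      rw [Finset.mem_union] at hu hv
      have h1 := hf u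
      have h2 := hf v
      have h3 := huv.symm
      have h4 := huv.ne
      by_cases hu' : u ∈ K <;> by_cases hv' : v ∈ K <;> simp only [hu', hv', if_true, if_false]
      · exact h4
      · intro e
        exact (h2 (hv.resolve_left hv')).2 (e ▸ h3)
      · intro e
        exact (h1 (hu.resolve_left hu')).2 (e ▸ huv)
      · intro e
        exact h4 (hi (hu.resolve_left hu') (hv.resolve_left hv') e))
    (fun v => decide (v ∈ K)) Finset.univ (fun v _ => Finset.mem_univ _)
    (by
      intro u hu v hv huv e
      rw [Finset.mem_union] at hu hv
      simp only [decide_eq_decide] at e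
      by_cases hu' : u ∈ K
      · exact hK.1 hu' (e.1 hu') huv
      · exact hQ (hu.resolve_left hu') (hv.resolve_left (fun h => hu' (e.2 h))) huv)
  rw [Finset.card_union_of_disjoint hd.symm] at h
  have hc : ({x, y, z} : Finset V).card = 3 := Finset.card_eq_three.2
    ⟨x, y, z, hxy.ne, hxz.ne, hyz.ne, rfl⟩
  simp only [Finset.card_univ, Fintype.card_bool] at h
  omega

/-- Three disjoint edges outside a maximum clique of a `1`-HNG graph do not split into a stable
triple and a triple inducing at most one edge. -/
lemma IsHNG.not_split (hG : IsHNG G 1) (hK : G.IsNClique G.cliqueNum K)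
    {x₁ y₁ x₂ y₂ x₃ y₃ : V} (hn : [x₁, y₁, x₂, y₂, x₃, y₃].Nodup)
    (hout : ∀ v ∈ [x₁, y₁, x₂, y₂, x₃, y₃], v ∉ K)
    (h₁ : G.Adj x₁ y₁) (h₂ : G.Adj x₂ y₂) (h₃ : G.Adj x₃ y₃) {a b c p q r : V}
    (hperm : ∀ v, v ∈ [a, b, c, p, q, r] ↔ v ∈ [x₁, y₁, x₂, y₂, x₃, y₃])
    (hab : ¬ G.Adj a b) (hac : ¬ G.Adj a c) (hbc : ¬ G.Adj b c)
    (hpr : ¬ G.Adj p r) (hqr : ¬ G.Adj q r) : False := by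
  classical
  have hmem : ∀ v ∈ [a, b, c, p, q, r], v ∉ K := fun v hv => hout v ((hperm v).1 hv)
  obtain ⟨k, hk, -⟩ := exists_nonadj hK (hmem a (by simp))
  let T : Finset V := [x₁, y₁, x₂, y₂, x₃, y₃].toFinset
  have hc : ∀ u ∈ ({c} : Set V), ∀ v ∈ ({c} : Set V), ¬ G.Adj u v := by simp
  obtain ⟨f, hfC, hf⟩ := exists_coloring hK ((K ∪ T : Finset V) : Set V) ({c} ∪ {a, b}) {r}
    (stable_union_pair hc hab (by simpa using hac) (by simpa using hbc))
    (hmem p (by simp)) (hmem q (by simp)) (by simp) (by simpa using hpr) (by simpa using hqr)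
    (by
      intro v hv hvK
      have hvT : v ∈ T := (Finset.mem_union.1 (Finset.mem_coe.1 hv)).resolve_left hvK
      have := (hperm v).2 (List.mem_toFinset.1 hvT)
      simp only [List.mem_cons, List.not_mem_nil, or_false] at this
      simp only [Set.mem_union, Set.mem_insert_iff, Set.mem_singleton_iff]
      tauto)
  have hd : Disjoint K T := by
    rw [Finset.disjoint_right]
    exact fun v hv => hout v (List.mem_toFinset.1 hv)
  have hT : T.card = 6 := List.toFinset_card_of_nodup hn
  have h := hG.card_le (K ∪ T) f K.insertNone (fun v _ => hfC v) hf
    (fun v => if v ∈ K then (0 : Fin 4) else if v = x₁ ∨ v = y₁ then 1 else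
      if v = x₂ ∨ v = y₂ then 2 else 3) Finset.univ (by simp)
    (by
      intro u hu v hv huv e
      have hK' : u ∈ K → v ∈ K → G.Adj u v := fun h h' => hK.1 h h' huv
      have hu' : u ∈ K ∨ u ∈ T := Finset.mem_union.1 hu
      have hv' : v ∈ K ∨ v ∈ T := Finset.mem_union.1 hv
      simp only [T, List.mem_toFinset, List.mem_cons, List.not_mem_nil, or_false] at hu' hv'
      have := h₁.symm
      have := h₂.symm
      have := h₃.symm
      clear hperm hout hn hf hfC hmem hT hd
      split_ifs at e <;> first | (exact absurd e (by decide)) | grind)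
  rw [Finset.card_union_of_disjoint hd, hT, Finset.card_insertNone, Finset.card_univ,
    Fintype.card_fin] at h
  omega

/-- Three disjoint edges outside a maximum clique of a `1`-HNG graph, where the first edge is
joined to the two others only crosswise, do not exist. -/
lemma IsHNG.not_cross_matching (hG : IsHNG G 1) (hK : G.IsNClique G.cliqueNum K)
    {x₁ y₁ x₂ y₂ x₃ y₃ : V} (hn : [x₁, y₁, x₂, y₂, x₃, y₃].Nodup)
    (hout : ∀ v ∈ [x₁, y₁, x₂, y₂, x₃, y₃], v ∉ K)
    (h₁ : G.Adj x₁ y₁) (h₂ : G.Adj x₂ y₂) (h₃ : G.Adj x₃ y₃)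
    (hx₂ : ¬ G.Adj x₁ x₂) (hy₂ : ¬ G.Adj y₁ y₂) (hx₃ : ¬ G.Adj x₁ x₃) (hy₃ : ¬ G.Adj y₁ y₃)
    (h₂₃ : (¬ G.Adj x₂ x₃ ∧ ¬ G.Adj y₂ y₃) ∨ (¬ G.Adj x₂ y₃ ∧ ¬ G.Adj y₂ x₃)) : False := by
  have key : ∀ a b c p q r : V,
      (∀ v, v ∈ [a, b, c, p, q, r] ↔ v ∈ [x₁, y₁, x₂, y₂, x₃, y₃]) →
      ¬ G.Adj a b → ¬ G.Adj a c → ¬ G.Adj b c → ¬ G.Adj p r → ¬ G.Adj q r → False :=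
    fun a b c p q r hperm hab hac hbc hpr hqr =>
      hG.not_split hK hn hout h₁ h₂ h₃ hperm hab hac hbc hpr hqr
  have htf : ∀ x ∈ [x₁, y₁, x₂, y₂, x₃, y₃], ∀ y ∈ [x₁, y₁, x₂, y₂, x₃, y₃],
      ∀ z ∈ [x₁, y₁, x₂, y₂, x₃, y₃], G.Adj x y → G.Adj x z → ¬ G.Adj y z :=
    fun x hx y hy z hz hxy hxz hyz =>
      hG.not_triangle hK (hout x hx) (hout y hy) (hout z hz) hxy hxz hyz
  have bipartite : ¬ G.Adj x₂ x₃ → ¬ G.Adj y₂ y₃ → False := fun hx hy =>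
    key x₁ x₂ x₃ y₁ y₂ y₃ (by simp [or_comm, or_left_comm]) hx₂ hx₃ hx hy₃ hy
  rcases h₂₃ with ⟨hx, hy⟩ | ⟨hxy, hyx⟩
  · exact bipartite hx hy
  · have hx : G.Adj x₁ y₂ → G.Adj x₁ y₃ → ¬ G.Adj y₂ y₃ :=
      htf x₁ (by simp) y₂ (by simp) y₃ (by simp)
    have hy : G.Adj y₁ x₂ → G.Adj y₁ x₃ → ¬ G.Adj x₂ x₃ :=
      htf y₁ (by simp) x₂ (by simp) x₃ (by simp)
    by_cases c₁ : G.Adj x₁ y₃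
    · by_cases c₂ : G.Adj x₁ y₂
      · by_cases c₃ : G.Adj y₁ x₃
        · by_cases c₄ : G.Adj y₁ x₂
          · exact bipartite (hy c₄ c₃) (hx c₂ c₁)
          · exact key y₁ y₃ x₂ x₁ y₂ x₃ (by simp [or_comm, or_left_comm]) hy₃ c₄ (fun h => hxy h.symm) hx₃ hyx
        · exact key y₁ y₂ x₃ x₁ y₃ x₂ (by simp [or_comm, or_left_comm]) hy₂ c₃ hyx hx₂ (fun h => hxy h.symm)
      · exact key x₁ x₃ y₂ y₁ x₂ y₃ (by simp [or_comm, or_left_comm]) hx₃ c₂ (fun h => hyx h.symm) hy₃ hxy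
    · exact key x₁ x₂ y₃ y₁ x₃ y₂ (by simp [or_comm, or_left_comm]) hx₂ c₁ hxy hy₂ (fun h => hyx h.symm)

/-- The complement of a maximum clique in a `1`-HNG graph has no three disjoint edges. -/
lemma IsHNG.not_matching (hG : IsHNG G 1) (hK : G.IsNClique G.cliqueNum K)
    {x₁ y₁ x₂ y₂ x₃ y₃ : V} (hn : [x₁, y₁, x₂, y₂, x₃, y₃].Nodup)
    (hout : ∀ v ∈ [x₁, y₁, x₂, y₂, x₃, y₃], v ∉ K)
    (h₁ : G.Adj x₁ y₁) (h₂ : G.Adj x₂ y₂) (h₃ : G.Adj x₃ y₃) : False := by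
  have pair : ∀ x y z w : V, x ∉ K → y ∉ K → z ∉ K → w ∉ K → G.Adj x y → G.Adj z w →
      (¬ G.Adj x z ∧ ¬ G.Adj y w) ∨ (¬ G.Adj x w ∧ ¬ G.Adj y z) := by
    intro x y z w hx hy hz hw hxy hzw
    have t₁ := fun h h' => hG.not_triangle hK hx hy hz hxy h h'
    have t₂ := fun h h' => hG.not_triangle hK hx hy hw hxy h h'
    have t₃ := fun h h' => hG.not_triangle hK hx hz hw h h' hzw
    have t₄ := fun h h' => hG.not_triangle hK hy hz hw h h' hzw
    tauto
  have o : x₁ ∉ K ∧ y₁ ∉ K ∧ x₂ ∉ K ∧ y₂ ∉ K ∧ x₃ ∉ K ∧ y₃ ∉ K := by simpa using hout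
  obtain ⟨ox₁, oy₁, ox₂, oy₂, ox₃, oy₃⟩ := o
  have h₂₃ := pair x₂ y₂ x₃ y₃ ox₂ oy₂ ox₃ oy₃ h₂ h₃
  have s₂ : [x₁, y₁, y₂, x₂, x₃, y₃].Perm [x₁, y₁, x₂, y₂, x₃, y₃] :=
    ((List.Perm.swap x₂ y₂ [x₃, y₃]).cons y₁).cons x₁
  have s₃ : ∀ x y, [x₁, y₁, x, y, y₃, x₃].Perm [x₁, y₁, x, y, x₃, y₃] := fun x y =>
    ((((List.Perm.swap x₃ y₃ []).cons y).cons x).cons y₁).cons x₁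
  have swap : ∀ l : List V, l.Perm [x₁, y₁, x₂, y₂, x₃, y₃] → l.Nodup ∧ ∀ v ∈ l, v ∉ K :=
    fun l h => ⟨h.nodup_iff.2 hn, fun v hv => hout v (h.mem_iff.1 hv)⟩
  rcases pair x₁ y₁ x₂ y₂ ox₁ oy₁ ox₂ oy₂ h₁ h₂ with h | h <;>
    rcases pair x₁ y₁ x₃ y₃ ox₁ oy₁ ox₃ oy₃ h₁ h₃ with h' | h'
  · exact hG.not_cross_matching hK hn hout h₁ h₂ h₃ h.1 h.2 h'.1 h'.2 h₂₃
  · obtain ⟨n, o⟩ := swap _ (s₃ x₂ y₂)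
    exact hG.not_cross_matching hK n o h₁ h₂ h₃.symm h.1 h.2 h'.1 h'.2 h₂₃.symm
  · obtain ⟨n, o⟩ := swap _ s₂
    exact hG.not_cross_matching hK n o h₁ h₂.symm h₃ h.1 h.2 h'.1 h'.2
      (h₂₃.symm.imp And.symm And.symm)
  · obtain ⟨n, o⟩ := swap _ ((s₃ y₂ x₂).trans s₂)
    exact hG.not_cross_matching hK n o h₁ h₂.symm h₃.symm h.1 h.2 h'.1 h'.2
      (h₂₃.imp And.symm And.symm)

/-- If the vertices outside a maximum clique form a stable set together with two vertices and a
stable set with no neighbour among these two, then `χ(G) ≤ ω(G) + 1`. -/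
lemma chi_le_of_split (hK : G.IsNClique G.cliqueNum K) (S Z : Set V)
    (hS : ∀ u ∈ S, ∀ v ∈ S, ¬ G.Adj u v) {p q : V} (hp : p ∉ K) (hq : q ∉ K)
    (hZ : ∀ u ∈ Z, ∀ v ∈ Z, ¬ G.Adj u v)
    (hpZ : ∀ v ∈ Z, ¬ G.Adj p v) (hqZ : ∀ v ∈ Z, ¬ G.Adj q v)
    (hs : ∀ v, v ∉ K → v ∈ S ∨ v = p ∨ v = q ∨ v ∈ Z) : chi G ≤ G.cliqueNum + 1 := by
  obtain ⟨f, hf, hadj⟩ := exists_coloring hK Set.univ S Z hS hp hq hZ hpZ hqZ (fun v _ => hs v)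
  have h := chi_le_card G f _ hf (fun u v => hadj u trivial v trivial)
  rwa [Finset.card_insertNone, hK.2] at h

/-- The bound `χ(G) ≤ ω(G) + 1` when the vertices outside a maximum clique are covered by two
disjoint edges `xy`, `zw` and a stable set `R` without neighbours of `x` and `z`. -/
lemma IsHNG.chi_le_of_two_edges (hG : IsHNG G 1) (hK : G.IsNClique G.cliqueNum K)
    {x y z w : V} (hn : [x, y, z, w].Nodup) (hx : x ∉ K) (hy : y ∉ K) (hz : z ∉ K) (hw : w ∉ K)
    (hxy : G.Adj x y) (hzw : G.Adj z w) (R : Set V) (hRK : ∀ v ∈ R, v ∉ K)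
    (hRn : ∀ v ∈ R, v ≠ x ∧ v ≠ y ∧ v ≠ z ∧ v ≠ w)
    (hcov : ∀ v, v ∉ K → v ∈ R ∨ v = x ∨ v = y ∨ v = z ∨ v = w)
    (hR : ∀ u ∈ R, ∀ v ∈ R, ¬ G.Adj u v)
    (hxR : ∀ u ∈ R, ¬ G.Adj x u) (hzR : ∀ u ∈ R, ¬ G.Adj z u) :
    chi G ≤ G.cliqueNum + 1 := by
  simp only [List.nodup_cons, List.mem_cons, List.not_mem_nil, or_false, not_or] at hn
  by_cases hxz : G.Adj x z
  · have hxw : ¬ G.Adj x w := fun h => hG.not_triangle hK hx hz hw hxz h hzw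
    have hyz : ¬ G.Adj y z := fun h => hG.not_triangle hK hx hy hz hxy hxz h
    by_cases hyR : ∃ r ∈ R, G.Adj y r
    · obtain ⟨r, hr, hyr⟩ := hyR
      have hwr : ∀ u ∈ R \ {r}, ¬ G.Adj w u := by
        rintro u ⟨hu, hur⟩ hwu
        have hrn := hRn r hr
        have hun := hRn u hu
        refine hG.not_matching hK (x₁ := y) (y₁ := r) (x₂ := x) (y₂ := z) (x₃ := w) (y₃ := u)
          ?_ ?_ hyr hxz hwu
        · rw [Set.mem_singleton_iff] at hur
          clear hG hK hcov hR hxR hzR hRK hRn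
          simp only [List.nodup_cons, List.mem_cons, List.not_mem_nil, or_false, not_or,
            List.nodup_nil, not_false_eq_true, and_true]
          grind
        · simp [hx, hy, hz, hw, hRK r hr, hRK u hu]
      refine chi_le_of_split hK (R \ {r} ∪ {x, w}) {z}
        (stable_union_pair (fun u hu v hv => hR u hu.1 v hv.1) hxw (fun u hu => hxR u hu.1) hwr)
        hy (hRK r hr) (by simp) (by simpa using hyz)
        (by simpa using fun h : G.Adj r z => hzR r hr h.symm) ?_
      intro v hv
      have := hcov v hv
      simp only [Set.mem_union, Set.mem_sdiff, Set.mem_insert_iff, Set.mem_singleton_iff]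
      tauto
    · have hyR' : ∀ u ∈ R, ¬ G.Adj y u := fun u hu h => hyR ⟨u, hu, h⟩
      refine chi_le_of_split hK (R ∪ {y, z}) ∅ (stable_union_pair hR hyz hyR' hzR)
        hx hw (by simp) (by simp) (by simp) ?_
      intro v hv
      have := hcov v hv
      simp only [Set.mem_union, Set.mem_insert_iff, Set.mem_singleton_iff]
      tauto
  · refine chi_le_of_split hK (R ∪ {x, z}) ∅ (stable_union_pair hR hxz hxR hzR)
      hy hw (by simp) (by simp) (by simp) ?_
    intro v hv
    have := hcov v hv
    simp only [Set.mem_union, Set.mem_insert_iff, Set.mem_singleton_iff]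
    tauto

end MaximumClique

/-- A `1`-HNG graph satisfies `χ(G) ≤ ω(G) + 1`: the class of `1`-HNG graphs is
`χ`-bounded by `f(x) = x + 1`. -/
theorem stmt_13 {V : Type*} [Fintype V] (G : SimpleGraph V) (hG : IsHNG G 1) :
    chi G ≤ G.cliqueNum + 1 := by
  obtain ⟨K, hK⟩ := G.exists_isNClique_cliqueNum
  by_cases hedge : ∃ x y, x ∉ K ∧ y ∉ K ∧ G.Adj x y
  swap
  · by_cases hall : ∀ v, v ∈ K
    · have h := chi_le_card G id K hall (fun u v h => h.ne)
      have := hK.2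
      omega
    · push Not at hall
      obtain ⟨p, hp⟩ := hall
      exact chi_le_of_split hK {v | v ∉ K} ∅ (fun u hu v hv h => hedge ⟨u, v, hu, hv, h⟩)
        hp hp (by simp) (by simp) (by simp) (fun v hv => Or.inl hv)
  have endpoint : ∀ x y : V, x ∉ K → y ∉ K → G.Adj x y → ∀ R : Set V, (∀ v ∈ R, v ∉ K) →
      (∀ u ∈ R, ∀ v ∈ R, u ≠ v → G.Adj x u → ¬ G.Adj y v) →
      (∀ u ∈ R, ¬ G.Adj x u) ∨ (∀ u ∈ R, ¬ G.Adj y u) := by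
    intro x y hx hy hxy R hRK hR
    by_contra! hcon
    obtain ⟨⟨u, hu, hxu⟩, v, hv, hyv⟩ := hcon
    by_cases huv : u = v
    · subst huv
      exact hG.not_triangle hK hx hy (hRK u hu) hxy hxu hyv
    · exact hR u hu v hv huv hxu hyv
  by_cases htwo : ∃ x y z w, x ∉ K ∧ y ∉ K ∧ z ∉ K ∧ w ∉ K ∧ G.Adj x y ∧ G.Adj z w ∧
      x ≠ z ∧ x ≠ w ∧ y ≠ z ∧ y ≠ w
  · obtain ⟨x, y, z, w, hx, hy, hz, hw, hxy, hzw, hxz, hxw, hyz, hyw⟩ := htwo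
    have hR : ∀ u ∈ {v | v ∉ K ∧ v ≠ x ∧ v ≠ y ∧ v ≠ z ∧ v ≠ w},
        ∀ v ∈ {v | v ∉ K ∧ v ≠ x ∧ v ≠ y ∧ v ≠ z ∧ v ≠ w}, ¬ G.Adj u v := by
      rintro u ⟨hu, hux, huy, huz, huw⟩ v ⟨hv, hvx, hvy, hvz, hvw⟩ huv
      refine hG.not_matching hK (x₁ := u) (y₁ := v) (x₂ := x) (y₂ := y) (x₃ := z) (y₃ := w)
        ?_ ?_ huv hxy hzw
      · simp [*, huv.ne, hxy.ne, hzw.ne]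
      · simp [*]
    have ex := endpoint x y hx hy hxy {v | v ∉ K ∧ v ≠ x ∧ v ≠ y ∧ v ≠ z ∧ v ≠ w}
      (fun v hv => hv.1) (by
        rintro u ⟨hu, hux, huy, huz, huw⟩ v ⟨hv, hvx, hvy, hvz, hvw⟩ huv hxu hyv
        refine hG.not_matching hK (x₁ := u) (y₁ := x) (x₂ := v) (y₂ := y) (x₃ := z) (y₃ := w)
          ?_ ?_ hxu.symm hyv.symm hzw
        · simp [*, hxy.ne, hzw.ne, hvx.symm]
        · simp [*])
    have ez := endpoint z w hz hw hzw {v | v ∉ K ∧ v ≠ x ∧ v ≠ y ∧ v ≠ z ∧ v ≠ w}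
      (fun v hv => hv.1) (by
        rintro u ⟨hu, hux, huy, huz, huw⟩ v ⟨hv, hvx, hvy, hvz, hvw⟩ huv hzu hwv
        refine hG.not_matching hK (x₁ := u) (y₁ := z) (x₂ := v) (y₂ := w) (x₃ := x) (y₃ := y)
          ?_ ?_ hzu.symm hwv.symm hxy
        · simp [*, hxy.ne, hzw.ne, hvz.symm, hxz.symm, hyz.symm, hxw.symm, hyw.symm]
        · simp [*])
    have key : ∀ x' y' z' w' : V, [x', y', z', w'].Perm [x, y, z, w] → G.Adj x' y' →
        G.Adj z' w' → (∀ u ∈ {v | v ∉ K ∧ v ≠ x ∧ v ≠ y ∧ v ≠ z ∧ v ≠ w}, ¬ G.Adj x' u) →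
        (∀ u ∈ {v | v ∉ K ∧ v ≠ x ∧ v ≠ y ∧ v ≠ z ∧ v ≠ w}, ¬ G.Adj z' u) →
        chi G ≤ G.cliqueNum + 1 := by
      intro x' y' z' w' hperm hxy' hzw' hxR hzR
      have hmem : ∀ v, v = x' ∨ v = y' ∨ v = z' ∨ v = w' ↔ v = x ∨ v = y ∨ v = z ∨ v = w :=
        fun v => by simpa using hperm.mem_iff (a := v)
      have hout : ∀ v, v = x' ∨ v = y' ∨ v = z' ∨ v = w' → v ∉ K := by
        intro v hv
        rcases (hmem v).1 hv with rfl | rfl | rfl | rfl <;> assumption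
      refine hG.chi_le_of_two_edges hK (hperm.nodup_iff.2 ?_) (hout x' (by simp))
        (hout y' (by simp)) (hout z' (by simp)) (hout w' (by simp)) hxy' hzw' _
        (fun v hv => hv.1) ?_ ?_ hR hxR hzR
      · simp [*, hxy.ne, hzw.ne]
      · intro v hv
        have h := (hmem v).not.2 (by simpa [not_or] using hv.2)
        simpa [not_or] using h
      · intro v hv
        rw [hmem v]
        simp only [Set.mem_ofPred_eq]
        tauto
    have s₁ : ∀ l, (y :: x :: l).Perm (x :: y :: l) := fun l => List.Perm.swap _ _ _
    have s₂ : [x, y, w, z].Perm [x, y, z, w] := ((List.Perm.swap _ _ _).cons _).cons _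
    rcases ex with hxR | hyR <;> rcases ez with hzR | hwR
    · exact key x y z w (List.Perm.refl _) hxy hzw hxR hzR
    · exact key x y w z s₂ hxy hzw.symm hxR hwR
    · exact key y x z w (s₁ _) hxy.symm hzw hyR hzR
    · exact key y x w z ((s₁ _).trans s₂) hxy.symm hzw.symm hyR hwR
  · obtain ⟨x, y, hx, hy, hxy⟩ := hedge
    have key : ∀ x y : V, x ∉ K → y ∉ K → G.Adj x y →
        (∀ u ∈ {v | v ∉ K ∧ v ≠ x ∧ v ≠ y}, ¬ G.Adj x u) → chi G ≤ G.cliqueNum + 1 := by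
      intro x y hx hy hxy hxR
      have hR : ∀ u ∈ {v | v ∉ K ∧ v ≠ x ∧ v ≠ y}, ∀ v ∈ {v | v ∉ K ∧ v ≠ x ∧ v ≠ y},
          ¬ G.Adj u v := fun u hu v hv huv =>
        htwo ⟨u, v, x, y, hu.1, hv.1, hx, hy, huv, hxy, hu.2.1, hu.2.2, hv.2.1, hv.2.2⟩
      refine chi_le_of_split hK _ ∅ (stable_union_pair hR G.irrefl hxR hxR) hy hy
        (by simp) (by simp) (by simp) ?_
      intro v hv
      simp only [Set.mem_union, Set.mem_insert_iff, Set.mem_singleton_iff, Set.mem_ofPred_eq]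
      tauto
    rcases endpoint x y hx hy hxy {v | v ∉ K ∧ v ≠ x ∧ v ≠ y} (fun v hv => hv.1)
      (fun u hu v hv huv hxu hyv =>
        htwo ⟨x, u, y, v, hx, hu.1, hy, hv.1, hxu, hyv, hxy.ne, hv.2.1.symm, hu.2.2, huv⟩)
      with h | h
    · exact key x y hx hy hxy h
    · exact key y x hy hx hxy.symm (fun u hu => h u ⟨hu.1, hu.2.2, hu.2.1⟩)
end

section
/- Let G be a finite simple graph whose vertex set is {c1,c2,c3,c4,c5} ∪ D, where c1,...,c5 induce a 5-cycle with edges exactly c1c2, c2c3, c3c4, c4c5, c1c5, the vertices of D are pairwise nonadjacent, and one of the following holds: (D1) every d ∈ D has neighborhood equal to one of {c1,c3}, {c1,c4}, {c1,c3,c4}; (D2) every d ∈ D has neighborhood equal to one of {c4}, {c1,c4}, {c1,c3,c4}; or (D3) every d ∈ D has neighborhood equal to one of {c1}, {c1,c3}, {c1,c4}. Then G is 1-HNG. -/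
open SimpleGraph

/-- A finite graph with a vertex cover `T` satisfies `|V| ≤ |T| + θ`. -/
theorem card_le_card_add_theta {V : Type*} [Fintype V] (G : SimpleGraph V) (T : Finset V)
    (hT : ∀ u v, G.Adj u v → u ∈ T ∨ v ∈ T) : Fintype.card V ≤ T.card + theta G := by
  classical
  obtain ⟨C⟩ : Gᶜ.Colorable (theta G) := colorable_chromaticNumber_of_fintype _
  have hle : Tᶜ.card ≤ (Finset.univ : Finset (Fin (theta G))).card := by
    refine Finset.card_le_card_of_injOn C (fun _ _ => Finset.mem_univ _) ?_
    intro u hu v hv huv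
    by_contra hne
    have hadj : Gᶜ.Adj u v := by
      refine (compl_adj G u v).mpr ⟨hne, fun h => ?_⟩
      simp only [Finset.coe_compl, Set.mem_compl_iff, Finset.mem_coe] at hu hv
      exact (hT u v h).elim hu hv
    exact C.valid hadj huv
  rw [Finset.card_fin] at hle
  have := Finset.card_add_card_compl T
  omega

/-- `G` is `1`-HNG as soon as every `n`-colorable induced subgraph has a vertex cover of size at
most `n`. -/
theorem isHNG_one_of_exists_cover {V : Type*} [Fintype V] (G : SimpleGraph V)
    (h : ∀ (s : Finset V) (n : ℕ), (G.induce (s : Set V)).Colorable n →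
      ∃ T : Finset V, T.card ≤ n ∧ ∀ u ∈ s, ∀ v ∈ s, G.Adj u v → u ∈ T ∨ v ∈ T) :
    IsHNG G 1 := by
  classical
  intro s
  obtain ⟨T, hTn, hT⟩ := h s (chi (G.induce (s : Set V)))
    (colorable_chromaticNumber_of_fintype _)
  have hcard := card_le_card_add_theta (G.induce (s : Set V))
    (T.subtype (fun x => x ∈ (s : Set V))) (fun u v huv => by
      simpa using hT u u.2 v v.2 huv)
  have hle : (T.subtype (fun x => x ∈ (s : Set V))).card ≤ T.card := by
    rw [Finset.card_subtype]
    exact Finset.card_filter_le _ _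
  have hs : Fintype.card ((s : Set V) : Type _) = s.card := by simp
  omega

/-- If `{a, b, c}` is a vertex cover of `G` with `b` and `c` adjacent, every neighbor of `b` other
than `c` is a neighbor of `a`, and the neighborhoods of `a` and `c` are nested up to one vertex,
then every bipartite induced subgraph has a vertex cover of size at most `2`. -/
theorem exists_cover_card_le_two {V : Type*} (G : SimpleGraph V) {a b c e : V}
    (hcov : ∀ u v, G.Adj u v → (u = a ∨ u = b ∨ u = c) ∨ (v = a ∨ v = b ∨ v = c))
    (hbc : G.Adj b c) (hb : ∀ v, G.Adj b v → v = c ∨ G.Adj a v)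
    (hac : (∀ v, G.Adj c v → v = b ∨ G.Adj a v) ∨ (∀ v, G.Adj a v → v = e ∨ G.Adj c v))
    (s : Finset V) (hs : (G.induce (s : Set V)).Colorable 2) :
    ∃ T : Finset V, T.card ≤ 2 ∧ ∀ u ∈ s, ∀ v ∈ s, G.Adj u v → u ∈ T ∨ v ∈ T := by
  classical
  obtain ⟨C⟩ := hs
  have key : ∀ x y : V, (∀ v ∈ s, a ∈ s → G.Adj a v → a = x ∨ a = y ∨ v = x ∨ v = y) →
      (∀ v ∈ s, b ∈ s → G.Adj b v → b = x ∨ b = y ∨ v = x ∨ v = y) →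
      (∀ v ∈ s, c ∈ s → G.Adj c v → c = x ∨ c = y ∨ v = x ∨ v = y) →
      ∃ T : Finset V, T.card ≤ 2 ∧ ∀ u ∈ s, ∀ v ∈ s, G.Adj u v → u ∈ T ∨ v ∈ T := by
    intro x y ha hb hc
    refine ⟨{x, y}, Finset.card_le_two, fun u hu v hv huv => ?_⟩
    simp only [Finset.mem_insert, Finset.mem_singleton]
    rcases hcov u v huv with (rfl | rfl | rfl) | (rfl | rfl | rfl)
    · have := ha v hv hu huv; tauto
    · have := hb v hv hu huv; tauto
    · have := hc v hv hu huv; tauto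
    · have := ha u hu hv huv.symm; tauto
    · have := hb u hu hv huv.symm; tauto
    · have := hc u hu hv huv.symm; tauto
  by_cases has : a ∈ s
  swap
  · exact key b c (by tauto) (by tauto) (by tauto)
  by_cases hbs : b ∈ s
  swap
  · exact key a c (by tauto) (by tauto) (by tauto)
  by_cases hcs : c ∈ s
  swap
  · exact key a b (by tauto) (by tauto) (by tauto)
  by_cases h2 : ∃ v ∈ s, G.Adj a v ∧ G.Adj b v
  swap
  · push Not at h2
    refine key a c (by tauto) (fun v hv _ hbv => ?_) (by tauto)
    rcases hb v hbv with h | h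
    · tauto
    · exact absurd hbv (h2 v hv h)
  by_cases h5 : ∃ v ∈ s, G.Adj a v ∧ G.Adj c v
  swap
  · push Not at h5
    rcases hac with hc | ha
    · refine key a b (by tauto) (by tauto) (fun v hv _ hcv => ?_)
      rcases hc v hcv with h | h
      · tauto
      · exact absurd hcv (h5 v hv h)
    · have haux : ∀ v ∈ s, G.Adj a v → v = e := fun v hv hav =>
        (ha v hav).resolve_right (h5 v hv hav)
      refine key e c (fun v hv _ hav => ?_) (fun v hv _ hbv => ?_) (by tauto)
      · have := haux v hv hav; tauto
      · rcases hb v hbv with h | h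
        · tauto
        · have := haux v hv h; tauto
  obtain ⟨v, hv, hav, hbv⟩ := h2
  obtain ⟨w, hw, haw, hcw⟩ := h5
  have hC : ∀ x y : V, ∀ (hx : x ∈ s) (hy : y ∈ s), G.Adj x y →
      (C ⟨x, hx⟩ : Fin 2) ≠ C ⟨y, hy⟩ := fun x y hx hy hxy => C.valid hxy
  have h1 := hC a v has hv hav
  have h2 := hC b v hbs hv hbv
  have h3 := hC a w has hw haw
  have h4 := hC c w hcs hw hcw
  have h5 := hC b c hbs hcs hbc
  omega

/-- If `G` consists of an induced `5`-cycle `c1 c2 c3 c4 c5` together with a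
stable set `D` of further vertices whose neighborhoods all come from one of the
families `D1`, `D2`, `D3`, then `G` is `1`-HNG. -/
theorem stmt_14 {V : Type*} [Fintype V] (G : SimpleGraph V)
    (c1 c2 c3 c4 c5 : V) (D : Set V)
    (hnodup : ([c1, c2, c3, c4, c5] : List V).Nodup)
    (hcover : ({c1, c2, c3, c4, c5} : Set V) ∪ D = Set.univ)
    (hdisj : Disjoint ({c1, c2, c3, c4, c5} : Set V) D)
    (h12 : G.Adj c1 c2) (h23 : G.Adj c2 c3) (h34 : G.Adj c3 c4) (h45 : G.Adj c4 c5)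
    (h15 : G.Adj c1 c5)
    (h13 : ¬ G.Adj c1 c3) (h14 : ¬ G.Adj c1 c4) (h24 : ¬ G.Adj c2 c4)
    (h25 : ¬ G.Adj c2 c5) (h35 : ¬ G.Adj c3 c5)
    (hDindep : D.Pairwise fun u v => ¬ G.Adj u v)
    (hcase :
      (∀ d ∈ D, G.neighborSet d = {c1, c3} ∨ G.neighborSet d = {c1, c4} ∨
        G.neighborSet d = {c1, c3, c4}) ∨
      (∀ d ∈ D, G.neighborSet d = {c4} ∨ G.neighborSet d = {c1, c4} ∨
        G.neighborSet d = {c1, c3, c4}) ∨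
      (∀ d ∈ D, G.neighborSet d = {c1} ∨ G.neighborSet d = {c1, c3} ∨
        G.neighborSet d = {c1, c4})) :
    IsHNG G 1 := by
  classical
  have hmem : ∀ v, (v = c1 ∨ v = c2 ∨ v = c3 ∨ v = c4 ∨ v = c5) ∨ v ∈ D := fun v => by
    have : v ∈ ({c1, c2, c3, c4, c5} : Set V) ∪ D := hcover ▸ Set.mem_univ v
    simpa using this
  have hD : ∀ d ∈ D, ∀ v, G.Adj d v → v = c1 ∨ v = c3 ∨ v = c4 := by
    intro d hd v hdv
    have hv : v ∈ G.neighborSet d := hdv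
    rcases hcase with h | h | h <;> rcases h d hd with h | h | h <;> rw [h] at hv <;>
      simp only [Set.mem_insert_iff, Set.mem_singleton_iff] at hv <;> tauto
  have hcov : ∀ u v, G.Adj u v → (u = c1 ∨ u = c3 ∨ u = c4) ∨ (v = c1 ∨ v = c3 ∨ v = c4) := by
    intro u v huv
    rcases hmem u with (rfl | rfl | rfl | rfl | rfl) | hu
    · tauto
    · rcases hmem v with (rfl | rfl | rfl | rfl | rfl) | hv
      all_goals first | tauto | exact absurd huv (G.irrefl) | exact Or.inl (hD v hv _ huv.symm)
    · tauto
    · tauto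
    · rcases hmem v with (rfl | rfl | rfl | rfl | rfl) | hv
      all_goals first
        | tauto
        | exact absurd huv (G.irrefl)
        | exact absurd huv.symm h25
        | exact Or.inl (hD v hv _ huv.symm)
    · exact Or.inr (hD u hu v huv)
  have hb : ∀ v, G.Adj c3 v → v = c4 ∨ G.Adj c1 v := by
    intro v hv
    rcases hmem v with (rfl | rfl | rfl | rfl | rfl) | hd
    · exact absurd hv.symm h13
    · exact Or.inr h12
    · exact absurd hv (G.irrefl)
    · exact Or.inl rfl
    · exact Or.inr h15
    · have n34 : c3 ≠ c4 := h34.ne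
      have h3 : c3 ∈ G.neighborSet v := hv.symm
      suffices c1 ∈ G.neighborSet v from Or.inr (G.adj_symm this)
      rcases hcase with h | h | h <;> rcases h v hd with h | h | h <;> rw [h] at h3 ⊢ <;>
        simp only [Set.mem_insert_iff, Set.mem_singleton_iff] at h3 ⊢ <;> tauto
  have hac : (∀ v, G.Adj c4 v → v = c3 ∨ G.Adj c1 v) ∨
      (∀ v, G.Adj c1 v → v = c2 ∨ G.Adj c4 v) := by
    have hc : (∀ d ∈ D, c4 ∈ G.neighborSet d → c1 ∈ G.neighborSet d) →
        ∀ v, G.Adj c4 v → v = c3 ∨ G.Adj c1 v := by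
      intro h v hv
      rcases hmem v with (rfl | rfl | rfl | rfl | rfl) | hd
      · exact absurd hv.symm h14
      · exact Or.inr h12
      · exact Or.inl rfl
      · exact absurd hv (G.irrefl)
      · exact Or.inr h15
      · exact Or.inr (G.adj_symm (h v hd hv.symm))
    rcases hcase with h | h | h
    · refine Or.inl (hc fun d hd h4 => ?_)
      rcases h d hd with h | h | h <;> rw [h] <;> simp
    · refine Or.inr fun v hv => ?_
      rcases hmem v with (rfl | rfl | rfl | rfl | rfl) | hd
      · exact absurd hv (G.irrefl)
      · exact Or.inl rfl
      · exact absurd hv h13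
      · exact absurd hv h14
      · exact Or.inr h45
      · suffices c4 ∈ G.neighborSet v from Or.inr (G.adj_symm this)
        rcases h v hd with h | h | h <;> rw [h] <;> simp
    · refine Or.inl (hc fun d hd h4 => ?_)
      rcases h d hd with h | h | h <;> rw [h] <;> simp
  refine isHNG_one_of_exists_cover G fun s n hs => ?_
  rcases Nat.lt_or_ge 2 n with hn | hn
  · refine ⟨{c1, c3, c4}, Finset.card_le_three.trans hn, fun u _ v _ huv => ?_⟩
    simpa using hcov u v huv
  rcases Nat.lt_or_ge n 2 with hn' | hn'
  · refine ⟨∅, Nat.zero_le _, fun u hu v hv huv => ?_⟩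
    obtain ⟨C⟩ := hs
    have hne : C ⟨u, hu⟩ ≠ C ⟨v, hv⟩ := C.valid huv
    omega
  · obtain rfl := le_antisymm hn hn'
    exact exists_cover_card_le_two G hcov h34 hb hac s hs
end

section
/- A finite simple graph G is bipartite and contains no three pairwise disjoint edges (no 3K2 subgraph) if and only if either (1) there exist two distinct nonadjacent vertices u, v such that every edge of G has exactly one endpoint in {u, v} (G is a subgraph of the complete bipartite graph K_{2,n−2}), or (2) there exist two distinct vertices u, v such that every edge of G is incident to u or to v and no vertex other than u and v is adjacent to both u and v (G is a subgraph of a double star), where G is assumed to have at least 2 vertices. -/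
open SimpleGraph

/-- `G` has three pairwise disjoint edges (a `3K₂` subgraph). -/
def HasThreeDisjointEdges {V : Type*} (G : SimpleGraph V) : Prop :=
  ∃ a b c d e f : V, ([a, b, c, d, e, f] : List V).Nodup ∧
    G.Adj a b ∧ G.Adj c d ∧ G.Adj e f

/-- Two disjoint edges from `P` to its complement in a graph without three disjoint edges:
some two of the four end vertices cover all edges. -/
theorem exists_cover_of_two_disjoint_edges {V : Type*} {G : SimpleGraph V} {P : V → Prop}
    (hP : ∀ x y, G.Adj x y → (P x ↔ ¬ P y)) (hG : ¬ HasThreeDisjointEdges G)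
    {a b c d : V} (hab : G.Adj a b) (hcd : G.Adj c d) (ha : P a) (hc : P c)
    (hac : a ≠ c) (hbd : b ≠ d) :
    ∃ u v : V, u ≠ v ∧ ∀ x y : V, G.Adj x y → P x → x = u ∨ x = v ∨ y = u ∨ y = v := by
  have hb : ¬ P b := (hP a b hab).1 ha
  have hd : ¬ P d := (hP c d hcd).1 hc
  have key : ∀ x₁ y₁ x₂ y₂ x₃ y₃, G.Adj x₁ y₁ → G.Adj x₂ y₂ → G.Adj x₃ y₃ →
      P x₁ → P x₂ → P x₃ → x₁ ≠ x₂ → x₁ ≠ x₃ → x₂ ≠ x₃ →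
      y₁ ≠ y₂ → y₁ ≠ y₃ → y₂ ≠ y₃ → False := by
    intro x₁ y₁ x₂ y₂ x₃ y₃ h₁ h₂ h₃ p₁ p₂ p₃ _ _ _ _ _ _
    have q₁ := (hP _ _ h₁).1 p₁
    have q₂ := (hP _ _ h₂).1 p₂
    have q₃ := (hP _ _ h₃).1 p₃
    refine hG ⟨x₁, y₁, x₂, y₂, x₃, y₃, ?_, h₁, h₂, h₃⟩
    simp only [List.nodup_cons, List.mem_cons, List.not_mem_nil, not_or]
    grind
  -- The augmenting path argument once a free neighbour of `b` and one of `c` are known.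
  have mixed : ∀ a b c d x y, G.Adj a b → G.Adj c d → P a → P c → a ≠ c → b ≠ d →
      G.Adj x b → P x → x ≠ a → x ≠ c → G.Adj c y → y ≠ b → y ≠ d →
      ∀ z w, G.Adj z w → P z → z = b ∨ z = c ∨ w = b ∨ w = c := by
    intro a b c d x y hab hcd ha hc hac hbd hxb hx hxa hxc hcy hyb hyd z w hzw hz
    by_contra! h
    obtain ⟨-, hzc, hwb, -⟩ := h
    by_cases hza : z = a <;> by_cases hwd : w = d
    · subst hza hwd
      exact key x b z w c y hxb hzw hcy hx hz hc hxa hxc hac hbd hyb.symm hyd.symm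
    · subst hza
      exact key x b z w c d hxb hzw hcd hx hz hc hxa hxc hac hwb.symm hbd hwd
    · subst hwd
      exact key a b z w c y hab hzw hcy ha hz hc (Ne.symm hza) hac hzc hbd hyb.symm hyd.symm
    · exact key a b z w c d hab hzw hcd ha hz hc (Ne.symm hza) hac hzc hwb.symm hbd hwd
  by_contra! hcon
  obtain ⟨x, y, hxy, hx, hxa, hxc, -, -⟩ := hcon a c hac
  obtain ⟨z, w, hzw, hz, -, -, hwb, hwd⟩ := hcon b d hbd
  have hy : y = b ∨ y = d := by
    by_contra! h
    exact key a b c d x y hab hcd hxy ha hc hx hac hxa.symm hxc.symm hbd h.1.symm h.2.symm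
  have hz' : z = a ∨ z = c := by
    by_contra! h
    exact key a b c d z w hab hcd hzw ha hc hz hac h.1.symm h.2.symm hbd hwb.symm hwd.symm
  rcases hy with rfl | rfl <;> rcases hz' with rfl | rfl
  · exact key x y z w c d hxy hzw hcd hx hz hc hxa hxc hac hwb.symm hbd hwd
  · obtain ⟨s, t, hst, hs, h⟩ := hcon y z (by rintro rfl; exact hb hc)
    have := mixed a y z d x w hab hcd ha hc hac hbd hxy hx hxa hxc hzw hwb hwd s t hst hs
    tauto
  · obtain ⟨s, t, hst, hs, h⟩ := hcon y z (by rintro rfl; exact hd ha)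
    have := mixed c y z b x w hcd hab hc ha hac.symm hbd.symm hxy hx hxc hxa hzw hwd hwb s t hst hs
    tauto
  · exact key x y z w a b hxy hzw hab hx hz ha hxc hxa hac.symm hwd.symm hbd.symm hwb

/-- König's theorem for matching number at most two: a bipartite graph without three disjoint
edges has two vertices meeting every edge. -/
theorem exists_cover_of_not_hasThreeDisjointEdges {V : Type*} [Nontrivial V]
    {G : SimpleGraph V} {P : V → Prop}
    (hP : ∀ x y, G.Adj x y → (P x ↔ ¬ P y)) (hG : ¬ HasThreeDisjointEdges G) :
    ∃ u v : V, u ≠ v ∧ ∀ x y : V, G.Adj x y → x = u ∨ x = v ∨ y = u ∨ y = v := by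
  suffices h : ∃ u v : V, u ≠ v ∧
      ∀ x y : V, G.Adj x y → P x → x = u ∨ x = v ∨ y = u ∨ y = v by
    obtain ⟨u, v, huv, h⟩ := h
    refine ⟨u, v, huv, fun x y hxy => ?_⟩
    by_cases hx : P x
    · exact h x y hxy hx
    · have := h y x hxy.symm ((hP y x hxy.symm).2 hx)
      tauto
  by_cases h₁ : ∃ a b, G.Adj a b ∧ P a
  · obtain ⟨a, b, hab, ha⟩ := h₁
    by_cases h₂ : ∃ c d, G.Adj c d ∧ P c ∧ a ≠ c ∧ b ≠ d
    · obtain ⟨c, d, hcd, hc, hac, hbd⟩ := h₂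
      exact exists_cover_of_two_disjoint_edges hP hG hab hcd ha hc hac hbd
    · refine ⟨a, b, hab.ne, fun x y hxy hx => ?_⟩
      by_contra! h
      exact h₂ ⟨x, y, hxy, hx, h.1.symm, h.2.2.2.symm⟩
  · obtain ⟨u, v, huv⟩ := exists_pair_ne V
    exact ⟨u, v, huv, fun x y hxy hx => (h₁ ⟨x, y, hxy, hx⟩).elim⟩

/-- If two vertices meet every edge, there are no three disjoint edges. -/
theorem not_hasThreeDisjointEdges_of_cover {V : Type*} {G : SimpleGraph V} {u v : V}
    (h : ∀ x y : V, G.Adj x y → x = u ∨ x = v ∨ y = u ∨ y = v) :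
    ¬ HasThreeDisjointEdges G := by
  rintro ⟨a, b, c, d, e, f, hn, hab, hcd, hef⟩
  simp only [List.nodup_cons, List.mem_cons, List.not_mem_nil, not_or] at hn
  have h₁ := h _ _ hab
  have h₂ := h _ _ hcd
  have h₃ := h _ _ hef
  grind

/-- A graph on at least two vertices is bipartite with no `3K₂` subgraph iff it
is a subgraph of `K_{2,n-2}` (all edges have exactly one endpoint in a fixed
nonadjacent pair `{u, v}`) or of a double star (all edges meet `{u, v}` and no
other vertex is adjacent to both `u` and `v`). -/
theorem stmt_15 {V : Type*} [Fintype V] (G : SimpleGraph V)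
    (hcard : 2 ≤ Fintype.card V) :
    ((∃ A B : Set V, A ∪ B = Set.univ ∧ Disjoint A B ∧
        (A.Pairwise fun x y => ¬ G.Adj x y) ∧ (B.Pairwise fun x y => ¬ G.Adj x y)) ∧
      ¬ HasThreeDisjointEdges G) ↔
    ((∃ u v : V, u ≠ v ∧ ¬ G.Adj u v ∧
        ∀ a b : V, G.Adj a b → Xor' (a = u ∨ a = v) (b = u ∨ b = v)) ∨
      (∃ u v : V, u ≠ v ∧
        (∀ a b : V, G.Adj a b → a = u ∨ a = v ∨ b = u ∨ b = v) ∧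
        (∀ w : V, w ≠ u → w ≠ v → ¬ (G.Adj w u ∧ G.Adj w v)))) := by
  constructor
  · rintro ⟨⟨A, B, hAB, hdisj, hA, hB⟩, hG⟩
    have : Nontrivial V := Fintype.one_lt_card_iff_nontrivial.1 hcard
    have hP : ∀ x y, G.Adj x y → (x ∈ A ↔ ¬ y ∈ A) := by
      intro x y hxy
      have hmem : ∀ z, z ∉ A → z ∈ B := fun z hz =>
        (hAB ▸ Set.mem_univ z : z ∈ A ∪ B).resolve_left hz
      constructor
      · exact fun hx hy => hA hx hy hxy.ne hxy
      · intro hy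
        by_contra hx
        exact hB (hmem x hx) (hmem y hy) hxy.ne hxy
    obtain ⟨u, v, huv, hcov⟩ := exists_cover_of_not_hasThreeDisjointEdges hP hG
    by_cases hside : u ∈ A ↔ v ∈ A
    · refine Or.inl ⟨u, v, huv, fun h => ?_, fun a b hab => ?_⟩
      · have := hP u v h
        tauto
      · have h₁ := hP a b hab
        have h₂ := hcov a b hab
        refine (xor_iff_not_iff _ _).2 ?_
        grind
    · refine Or.inr ⟨u, v, huv, fun a b hab => hcov a b hab, fun w _ _ h => ?_⟩
      have h₁ := hP w u h.1
      have h₂ := hP w v h.2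
      tauto
  · rintro (⟨u, v, -, -, h⟩ | ⟨u, v, huv, hcov, h⟩)
    · refine ⟨⟨{u, v}, {u, v}ᶜ, Set.union_compl_self _, disjoint_compl_right, ?_, ?_⟩,
        not_hasThreeDisjointEdges_of_cover (u := u) (v := v) fun x y hxy => ?_⟩
      · intro x hx y hy _ hxy
        exact (h x y hxy).elim (fun k => k.2 hy) (fun k => k.2 hx)
      · intro x hx y hy _ hxy
        exact (h x y hxy).elim (fun k => hx k.1) (fun k => hy k.1)
      · have := h x y hxy
        exact this.elim (fun k => by tauto) (fun k => by tauto)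
    · refine ⟨⟨{w | w = v ∨ G.Adj w u}ᶜ, {w | w = v ∨ G.Adj w u}, Set.compl_union_self _,
        disjoint_compl_left, ?_, ?_⟩, not_hasThreeDisjointEdges_of_cover hcov⟩
      · intro x hx y hy _ hxy
        simp only [Set.mem_compl_iff, Set.mem_ofPred_eq, not_or] at hx hy
        rcases hcov x y hxy with rfl | rfl | rfl | rfl
        · exact hy.2 hxy.symm
        · exact hx.1 rfl
        · exact hx.2 hxy
        · exact hy.1 rfl
      · have hu : ∀ w, (w = v ∨ G.Adj w u) → w ≠ u := by
          rintro w (rfl | hw)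
          · exact huv.symm
          · exact hw.ne
        intro x hx y hy hne hxy
        have hxu := hu x hx
        have hyu := hu y hy
        rcases hcov x y hxy with rfl | rfl | rfl | rfl
        · exact hxu rfl
        · exact h y hyu hne.symm ⟨hy.resolve_left hne.symm, hxy.symm⟩
        · exact hyu rfl
        · exact h x hxu hne ⟨hx.resolve_left hne, hxy⟩
end
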